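/- arXiv:1711.04456 — 10 statements merged into one kernel-verified Lean document; each statement's English description precedes it below -/
import Mathlib

section
/- Let n ≥ 4 and λ > 0, and let Γ and Γ' be triangulations of the convex n-gon that are related by a Whitehead move in the quadrilateral with vertices a < b < c < d (i.e. Γ contains the diagonal {a,c} together with the triangles (a,b,c) and (a,c,d), and Γ' = (Γ \ {{a,c}}) ∪ {{b,d}}). Then the map ℝ^{Prn Γ} → ℝ^{Prn Γ'} which fixes all common coordinates u_{ij} for ε(i,j) ∈ Prn Γ ∩ Prn Γ' and sends u_{ac} to u_{bd} = −u_{ac} + u_{ab} + u_{bc} + u_{cd} + u_{ad} − min( u_{ab} + u_{cd} , u_{ad} + u_{bc} − Σ_{i=b}^{c−1} u_{i,i+1} ) (with the convention u_{1n} := λ wherever the pair (1,n) occurs) restricts to a bijection from Δ_Γ onto Δ_{Γ'}. -/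
/-- The sides `(i, i+1)`, `1 ≤ i ≤ n−1`, of the convex `n`-gon. -/
def polygonSides (n : ℕ) : Finset (ℕ × ℕ) :=
  (Finset.Ico 1 n).image (fun i => (i, i + 1))

/-- `Prn Γ`: the diagonals of the triangulation `Γ` together with the sides
`(i, i+1)`, `1 ≤ i ≤ n−1` (i.e. all edges except `(1, n)`). -/
def prnEdges (n : ℕ) (Γ : Finset (ℕ × ℕ)) : Finset (ℕ × ℕ) :=
  Γ ∪ polygonSides n

/-- All edges of the triangulation `Γ`: diagonals, sides, and the side `(1, n)`. -/
def edgeSet (n : ℕ) (Γ : Finset (ℕ × ℕ)) : Finset (ℕ × ℕ) :=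
  prnEdges n Γ ∪ {(1, n)}

/-- A triangulation of the convex `n`-gon: a set of `n−3` pairwise non-crossing
diagonals `(i,j)`, `1 ≤ i`, `i+2 ≤ j ≤ n`, `(i,j) ≠ (1,n)`; non-crossing of `(i,j)` and
`(k,l)` means `I(i,j) ⊆ I(k,l)`, `I(k,l) ⊆ I(i,j)`, or `I(i,j) ∩ I(k,l) = ∅`, where
`I(i,j) = {i, …, j−1}`. -/
def IsTriangulation (n : ℕ) (Γ : Finset (ℕ × ℕ)) : Prop :=
  Γ.card = n - 3 ∧
  (∀ e ∈ Γ, 1 ≤ e.1 ∧ e.1 + 2 ≤ e.2 ∧ e.2 ≤ n ∧ e ≠ (1, n)) ∧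
  ∀ e ∈ Γ, ∀ f ∈ Γ,
    Finset.Ico e.1 e.2 ⊆ Finset.Ico f.1 f.2 ∨
    Finset.Ico f.1 f.2 ⊆ Finset.Ico e.1 e.2 ∨
    Disjoint (Finset.Ico e.1 e.2) (Finset.Ico f.1 f.2)

/-- Extension of a coordinate vector `u ∈ ℝ^{Prn Γ}` to all pairs, with the convention
`u_{1n} := λ`. -/
noncomputable def extCoord (n : ℕ) (lam : ℝ) (Γ : Finset (ℕ × ℕ))
    (u : {e // e ∈ prnEdges n Γ} → ℝ) : ℕ × ℕ → ℝ :=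
  fun e => if h : e ∈ prnEdges n Γ then u ⟨e, h⟩ else if e = (1, n) then lam else 0

/-- The polytope `Δ_Γ ⊆ ℝ^{Prn Γ}` defined, for every triangle `i < j < k` of `Γ`, by
`u_{ik} ≥ u_{ij} − u_{jk} + Σ_{l=j}^{k−1} u_{l,l+1}`,
`u_{ik} ≥ u_{jk} − u_{ij} + Σ_{l=i}^{j−1} u_{l,l+1}`, and `u_{ik} ≤ u_{ij} + u_{jk}`
(with the convention `u_{1n} := λ`). -/
noncomputable def deltaPolytope (n : ℕ) (lam : ℝ) (Γ : Finset (ℕ × ℕ)) :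
    Set ({e // e ∈ prnEdges n Γ} → ℝ) :=
  {u | ∀ i j k : ℕ, i < j → j < k →
    (i, j) ∈ edgeSet n Γ → (j, k) ∈ edgeSet n Γ → (i, k) ∈ edgeSet n Γ →
    (extCoord n lam Γ u (i, k) ≥
        extCoord n lam Γ u (i, j) - extCoord n lam Γ u (j, k) +
          ∑ l ∈ Finset.Ico j k, extCoord n lam Γ u (l, l + 1)) ∧
    (extCoord n lam Γ u (i, k) ≥
        extCoord n lam Γ u (j, k) - extCoord n lam Γ u (i, j) +
          ∑ l ∈ Finset.Ico i j, extCoord n lam Γ u (l, l + 1)) ∧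
    extCoord n lam Γ u (i, k) ≤ extCoord n lam Γ u (i, j) + extCoord n lam Γ u (j, k)}

/-- The defining inequalities of `deltaPolytope` attached to the triangle `i < j < k`. -/
def TriangleIneq (v : ℕ × ℕ → ℝ) (i j k : ℕ) : Prop :=
  v (i, k) ≥ v (i, j) - v (j, k) + ∑ l ∈ Finset.Ico j k, v (l, l + 1) ∧
  v (i, k) ≥ v (j, k) - v (i, j) + ∑ l ∈ Finset.Ico i j, v (l, l + 1) ∧
  v (i, k) ≤ v (i, j) + v (j, k)

/-- `i < j < k` is a triangle all of whose edges lie in `E`. -/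
def IsTriangleIn (E : Finset (ℕ × ℕ)) (i j k : ℕ) : Prop :=
  i < j ∧ j < k ∧ (i, j) ∈ E ∧ (j, k) ∈ E ∧ (i, k) ∈ E

/-- `Γ'` arises from `Γ` by replacing the diagonal `p` by the diagonal `q`. -/
structure IsExchange (n : ℕ) (Γ Γ' : Finset (ℕ × ℕ)) (p q : ℕ × ℕ) : Prop where
  mem_left : p ∈ prnEdges n Γ
  notMem_right : p ∉ prnEdges n Γ'
  mem_right : q ∈ prnEdges n Γ'
  notMem_left : q ∉ prnEdges n Γ
  left_ne : p ≠ (1, n)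
  right_ne : q ≠ (1, n)
  left_length : p.1 + 2 ≤ p.2
  right_length : q.1 + 2 ≤ q.2
  mem_iff : ∀ e, e ≠ p → e ≠ q → (e ∈ prnEdges n Γ ↔ e ∈ prnEdges n Γ')

/-- The coordinate change replacing the coordinate at `p` by the coordinate `C - u_p` at `q`. -/
noncomputable def exchangeMap (n : ℕ) (lam : ℝ) (Γ Γ' : Finset (ℕ × ℕ)) (p q : ℕ × ℕ)
    (C : (ℕ × ℕ → ℝ) → ℝ) (u : {e // e ∈ prnEdges n Γ} → ℝ) :
    {e // e ∈ prnEdges n Γ'} → ℝ :=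
  fun e => if (e : ℕ × ℕ) = q then C (extCoord n lam Γ u) - extCoord n lam Γ u p
    else extCoord n lam Γ u e

/-- The sum of the two diagonal coordinates of the quadrilateral `a < b < c < d`, expressed
through the coordinates of its sides. -/
noncomputable def diagonalSum (a b c d : ℕ) (v : ℕ × ℕ → ℝ) : ℝ :=
  v (a, b) + v (b, c) + v (c, d) + v (a, d) -
    min (v (a, b) + v (c, d)) (v (a, d) + v (b, c) - ∑ i ∈ Finset.Ico b c, v (i, i + 1))

theorem extCoord_coe {n : ℕ} {lam : ℝ} {Γ : Finset (ℕ × ℕ)}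
    (u : {e // e ∈ prnEdges n Γ} → ℝ) (e : {e // e ∈ prnEdges n Γ}) :
    extCoord n lam Γ u e = u e := by
  simp [extCoord]

namespace IsExchange

variable {n : ℕ} {Γ Γ' : Finset (ℕ × ℕ)} {p q : ℕ × ℕ}

theorem symm (h : IsExchange n Γ Γ' p q) : IsExchange n Γ' Γ q p :=
  ⟨h.mem_right, h.notMem_left, h.mem_left, h.notMem_right, h.right_ne, h.left_ne,
    h.right_length, h.left_length, fun e hq hp => (h.mem_iff e hp hq).symm⟩

theorem ne (h : IsExchange n Γ Γ' p q) : p ≠ q := fun e => h.notMem_left (e ▸ h.mem_left)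

theorem extCoord_exchangeMap_right (h : IsExchange n Γ Γ' p q) (lam : ℝ)
    (C : (ℕ × ℕ → ℝ) → ℝ) (u : {e // e ∈ prnEdges n Γ} → ℝ) :
    extCoord n lam Γ' (exchangeMap n lam Γ Γ' p q C u) q =
      C (extCoord n lam Γ u) - extCoord n lam Γ u p := by
  simp [extCoord, exchangeMap, h.mem_right]

theorem extCoord_exchangeMap_of_ne (h : IsExchange n Γ Γ' p q) (lam : ℝ)
    (C : (ℕ × ℕ → ℝ) → ℝ) (u : {e // e ∈ prnEdges n Γ} → ℝ) {e : ℕ × ℕ}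
    (hp : e ≠ p) (hq : e ≠ q) :
    extCoord n lam Γ' (exchangeMap n lam Γ Γ' p q C u) e = extCoord n lam Γ u e := by
  have := h.mem_iff e hp hq
  by_cases he : e ∈ prnEdges n Γ'
  · rw [extCoord, dif_pos he, exchangeMap, if_neg hq]
  · simp [extCoord, this, he]

theorem exchangeMap_leftInverse (h : IsExchange n Γ Γ' p q) (lam : ℝ)
    {C : (ℕ × ℕ → ℝ) → ℝ}
    (hC : ∀ v w : ℕ × ℕ → ℝ, (∀ e, e ≠ p → e ≠ q → v e = w e) → C v = C w) :
    Function.LeftInverse (exchangeMap n lam Γ' Γ q p C) (exchangeMap n lam Γ Γ' p q C) := by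
  intro u
  ext e
  have hCu := hC _ _ fun e hp hq => h.extCoord_exchangeMap_of_ne lam C u hp hq
  by_cases hp : (e : ℕ × ℕ) = p
  · rw [exchangeMap, if_pos hp, h.extCoord_exchangeMap_right, hCu, sub_sub_cancel, ← hp,
      extCoord_coe]
  · have hq : (e : ℕ × ℕ) ≠ q := fun hq => h.notMem_left (hq ▸ e.2)
    rw [exchangeMap, if_neg hp, h.extCoord_exchangeMap_of_ne lam C u hp hq, extCoord_coe]

theorem bijOn_exchangeMap (h : IsExchange n Γ Γ' p q) (lam : ℝ) {C : (ℕ × ℕ → ℝ) → ℝ}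
    (hC : ∀ v w : ℕ × ℕ → ℝ, (∀ e, e ≠ p → e ≠ q → v e = w e) → C v = C w)
    {s : Set ({e // e ∈ prnEdges n Γ} → ℝ)} {t : Set ({e // e ∈ prnEdges n Γ'} → ℝ)}
    (hst : ∀ u, u ∈ s ↔ exchangeMap n lam Γ Γ' p q C u ∈ t) :
    Set.BijOn (exchangeMap n lam Γ Γ' p q C) s t := by
  have hl := h.exchangeMap_leftInverse lam hC
  have hr := h.symm.exchangeMap_leftInverse lam
    fun v w hvw => hC v w fun e hp hq => hvw e hq hp
  refine Set.InvOn.bijOn ⟨hl.leftInvOn s, hr.leftInvOn t⟩ (fun u hu => (hst u).1 hu)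
    fun u hu => (hst _).2 ?_
  rwa [hr u]

theorem mem_edgeSet_iff (h : IsExchange n Γ Γ' p q) {e : ℕ × ℕ} (hp : e ≠ p) (hq : e ≠ q) :
    e ∈ edgeSet n Γ ↔ e ∈ edgeSet n Γ' := by
  simp only [edgeSet, Finset.mem_union, h.mem_iff e hp hq]

theorem edgeSet_erase (h : IsExchange n Γ Γ' p q) :
    (edgeSet n Γ).erase p = (edgeSet n Γ').erase q := by
  ext e
  have hpΓ' : p ∉ edgeSet n Γ' := by simp [edgeSet, h.notMem_right, h.left_ne]
  have hqΓ : q ∉ edgeSet n Γ := by simp [edgeSet, h.notMem_left, h.right_ne]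
  by_cases hp : e = p
  · subst hp; simp [hpΓ']
  by_cases hq : e = q
  · subst hq; simp [hqΓ]
  simp [hp, hq, h.mem_edgeSet_iff hp hq]

theorem side_ne (h : IsExchange n Γ Γ' p q) (l : ℕ) : (l, l + 1) ≠ p ∧ (l, l + 1) ≠ q := by
  have := h.left_length
  have := h.right_length
  constructor <;> rintro rfl <;> simp_all

end IsExchange

theorem TriangleIneq.congr {v w : ℕ × ℕ → ℝ} {i j k : ℕ}
    (hsides : ∀ l, v (l, l + 1) = w (l, l + 1)) (hij : v (i, j) = w (i, j))
    (hjk : v (j, k) = w (j, k)) (hik : v (i, k) = w (i, k)) :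
    TriangleIneq v i j k ↔ TriangleIneq w i j k := by
  simp only [TriangleIneq, hsides, hij, hjk, hik]

theorem mem_deltaPolytope_iff {n : ℕ} {lam : ℝ} {Γ : Finset (ℕ × ℕ)}
    {u : {e // e ∈ prnEdges n Γ} → ℝ} :
    u ∈ deltaPolytope n lam Γ ↔
      ∀ i j k, IsTriangleIn (edgeSet n Γ) i j k →
        TriangleIneq (extCoord n lam Γ u) i j k :=
  ⟨fun h i j k ⟨hij, hjk, h₁, h₂, h₃⟩ => h i j k hij hjk h₁ h₂ h₃,
    fun h i j k hij hjk h₁ h₂ h₃ => h i j k ⟨hij, hjk, h₁, h₂, h₃⟩⟩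

theorem IsTriangleIn.mono {E F : Finset (ℕ × ℕ)} (hEF : E ⊆ F) {i j k : ℕ}
    (h : IsTriangleIn E i j k) : IsTriangleIn F i j k :=
  ⟨h.1, h.2.1, hEF h.2.2.1, hEF h.2.2.2.1, hEF h.2.2.2.2⟩

/-- Separating off the triangles that contain a given edge. -/
theorem forall_isTriangleIn_iff {E : Finset (ℕ × ℕ)} {p : ℕ × ℕ} {i₁ j₁ k₁ i₂ j₂ k₂ : ℕ}
    {P : ℕ → ℕ → ℕ → Prop} (h₁ : IsTriangleIn E i₁ j₁ k₁) (h₂ : IsTriangleIn E i₂ j₂ k₂)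
    (hp : ∀ i j k, IsTriangleIn E i j k → (i, j) = p ∨ (j, k) = p ∨ (i, k) = p →
      (i = i₁ ∧ j = j₁ ∧ k = k₁) ∨ (i = i₂ ∧ j = j₂ ∧ k = k₂)) :
    (∀ i j k, IsTriangleIn E i j k → P i j k) ↔
      (∀ i j k, IsTriangleIn (E.erase p) i j k → P i j k) ∧ P i₁ j₁ k₁ ∧ P i₂ j₂ k₂ := by
  refine ⟨fun h => ⟨fun i j k hT => h i j k (hT.mono (Finset.erase_subset _ _)),
    h _ _ _ h₁, h _ _ _ h₂⟩, fun ⟨h, hP₁, hP₂⟩ i j k hT => ?_⟩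
  by_cases hmem : (i, j) = p ∨ (j, k) = p ∨ (i, k) = p
  · obtain ⟨rfl, rfl, rfl⟩ | ⟨rfl, rfl, rfl⟩ := hp i j k hT hmem <;> assumption
  · push Not at hmem
    exact h i j k ⟨hT.1, hT.2.1, Finset.mem_erase.2 ⟨hmem.1, hT.2.2.1⟩,
      Finset.mem_erase.2 ⟨hmem.2.1, hT.2.2.2.1⟩, Finset.mem_erase.2 ⟨hmem.2.2, hT.2.2.2.2⟩⟩

theorem mem_edgeSet {n : ℕ} {Γ : Finset (ℕ × ℕ)} {i j : ℕ} :
    (i, j) ∈ edgeSet n Γ ↔ (i, j) ∈ Γ ∨ (1 ≤ i ∧ i < n ∧ j = i + 1) ∨ (i = 1 ∧ j = n) := by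
  simp only [edgeSet, prnEdges, polygonSides, Finset.mem_union, Finset.mem_image,
    Finset.mem_Ico, Finset.mem_singleton, Prod.mk.injEq]
  grind

theorem mem_prnEdges {n : ℕ} {Γ : Finset (ℕ × ℕ)} {i j : ℕ} :
    (i, j) ∈ prnEdges n Γ ↔ (i, j) ∈ Γ ∨ (1 ≤ i ∧ i < n ∧ j = i + 1) := by
  simp only [prnEdges, polygonSides, Finset.mem_union, Finset.mem_image,
    Finset.mem_Ico, Prod.mk.injEq]
  grind

theorem IsTriangulation.not_crossing {n : ℕ} {Γ : Finset (ℕ × ℕ)} (h : IsTriangulation n Γ)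
    {i j k l : ℕ} (hik : (i, k) ∈ edgeSet n Γ) (hjl : (j, l) ∈ edgeSet n Γ) (hij : i < j)
    (hjk : j < k) (hkl : k < l) : False := by
  obtain ⟨-, hrange, hcross⟩ := h
  rw [mem_edgeSet] at hik hjl
  have hln : (j, l) ∈ Γ → l ≤ n := fun h => (hrange _ h).2.2.1
  have hi : (i, k) ∈ Γ → 1 ≤ i := fun h => (hrange _ h).1
  have hikΓ : (i, k) ∈ Γ := by
    rcases hik with h | h | h
    · exact h
    · omega
    · rcases hjl with h' | h' | h'
      · have := hln h'; omega
      · omega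
      · omega
  have hjlΓ : (j, l) ∈ Γ := by
    have := hi hikΓ
    rcases hjl with h | h | h
    · exact h
    · omega
    · omega
  rcases hcross _ hikΓ _ hjlΓ with h | h | h
  · have : i ∈ Finset.Ico j l := h (by simp; omega)
    simp at this; omega
  · have : k ∈ Finset.Ico i k := h (by simp; omega)
    simp at this
  · exact Finset.disjoint_left.1 h (Finset.mem_Ico.2 ⟨hij.le, hjk⟩)
      (Finset.mem_Ico.2 ⟨le_rfl, hjk.trans hkl⟩)

/-- The only triangles on the diagonal `(a, c)` are the two in the quadrilateral. -/
theorem IsTriangulation.triangle_of_mem_left {n : ℕ} {Γ : Finset (ℕ × ℕ)}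
    (h : IsTriangulation n Γ) {a b c d : ℕ} (hab : a < b) (hbc : b < c) (hcd : c < d)
    (hAB : (a, b) ∈ edgeSet n Γ) (hBC : (b, c) ∈ edgeSet n Γ)
    (hCD : (c, d) ∈ edgeSet n Γ) (hAD : (a, d) ∈ edgeSet n Γ) (i j k : ℕ)
    (hT : IsTriangleIn (edgeSet n Γ) i j k)
    (hp : (i, j) = (a, c) ∨ (j, k) = (a, c) ∨ (i, k) = (a, c)) :
    (i = a ∧ j = b ∧ k = c) ∨ (i = a ∧ j = c ∧ k = d) := by
  obtain ⟨hij, hjk, hIJ, hJK, hIK⟩ := hT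
  simp only [Prod.mk.injEq] at hp
  rcases hp with ⟨rfl, rfl⟩ | ⟨rfl, rfl⟩ | ⟨rfl, rfl⟩
  · rcases lt_trichotomy k d with hk | rfl | hk
    · exact (h.not_crossing hIK hCD hij hjk hk).elim
    · simp
    · exact (h.not_crossing hAD hJK hij hcd hk).elim
  · exact (h.not_crossing hIK hAD hij hjk hcd).elim
  · rcases lt_trichotomy j b with hj | rfl | hj
    · exact (h.not_crossing hAB hJK hij hj hbc).elim
    · simp
    · exact (h.not_crossing hIJ hBC hab hj hjk).elim

/-- The only triangles on the diagonal `(b, d)` are the two in the quadrilateral. -/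
theorem IsTriangulation.triangle_of_mem_right {n : ℕ} {Γ : Finset (ℕ × ℕ)}
    (h : IsTriangulation n Γ) {a b c d : ℕ} (hab : a < b) (hbc : b < c) (hcd : c < d)
    (hAB : (a, b) ∈ edgeSet n Γ) (hBC : (b, c) ∈ edgeSet n Γ)
    (hCD : (c, d) ∈ edgeSet n Γ) (hAD : (a, d) ∈ edgeSet n Γ) (i j k : ℕ)
    (hT : IsTriangleIn (edgeSet n Γ) i j k)
    (hp : (i, j) = (b, d) ∨ (j, k) = (b, d) ∨ (i, k) = (b, d)) :
    (i = b ∧ j = c ∧ k = d) ∨ (i = a ∧ j = b ∧ k = d) := by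
  obtain ⟨hij, hjk, hIJ, hJK, hIK⟩ := hT
  simp only [Prod.mk.injEq] at hp
  rcases hp with ⟨rfl, rfl⟩ | ⟨rfl, rfl⟩ | ⟨rfl, rfl⟩
  · exact (h.not_crossing hAD hIK hab hij hjk).elim
  · rcases lt_trichotomy i a with hi | rfl | hi
    · exact (h.not_crossing hIJ hAD hi hab hjk).elim
    · simp
    · exact (h.not_crossing hAB hIK hi hij hjk).elim
  · rcases lt_trichotomy j c with hj | rfl | hj
    · exact (h.not_crossing hBC hJK hij hj hcd).elim
    · simp
    · exact (h.not_crossing hIJ hCD hbc hj hjk).elim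

theorem isExchange_of_flip {n : ℕ} {Γ Γ' : Finset (ℕ × ℕ)} {a b c d : ℕ}
    (hΓ : IsTriangulation n Γ) (hΓ' : IsTriangulation n Γ') (hab : a < b) (hbc : b < c)
    (hcd : c < d) (hac : (a, c) ∈ Γ) (hflip : Γ' = Γ.erase (a, c) ∪ {(b, d)}) :
    IsExchange n Γ Γ' (a, c) (b, d) := by
  have hbd : (b, d) ∈ Γ' := by simp [hflip]
  have hacr := hΓ.2.1 _ hac
  have hbdr := hΓ'.2.1 _ hbd
  have hbdΓ : (b, d) ∉ Γ := fun h =>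
    hΓ.not_crossing (mem_edgeSet.2 (.inl hac)) (mem_edgeSet.2 (.inl h)) hab hbc hcd
  have hacΓ' : (a, c) ∉ Γ' := by simp [hflip]; omega
  refine ⟨mem_prnEdges.2 (.inl hac), ?_, mem_prnEdges.2 (.inl hbd), ?_, hacr.2.2.2,
    hbdr.2.2.2, hacr.2.1, hbdr.2.1, fun e hp hq => ?_⟩
  · rw [mem_prnEdges]; rintro (h | h)
    · exact hacΓ' h
    · omega
  · rw [mem_prnEdges]; rintro (h | h)
    · exact hbdΓ h
    · omega
  · simp [prnEdges, hflip, hp, hq]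

/-- Inside a quadrilateral, the piecewise linear relation between the two diagonal coordinates
exchanges the triangle inequalities of the two triangulations. -/
theorem triangleIneq_quadrilateral_iff {v w : ℕ × ℕ → ℝ} {a b c d : ℕ} (hab : a < b)
    (hbc : b < c) (hcd : c < d) (hvw : ∀ e, e ≠ (a, c) → e ≠ (b, d) → w e = v e)
    (hsides : ∀ l, w (l, l + 1) = v (l, l + 1))
    (hdiag : w (b, d) = diagonalSum a b c d v - v (a, c)) :
    (TriangleIneq v a b c ∧ TriangleIneq v a c d) ↔
      (TriangleIneq w b c d ∧ TriangleIneq w a b d) := by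
  have hAB : w (a, b) = v (a, b) := hvw _ (by simp; omega) (by simp; omega)
  have hBC : w (b, c) = v (b, c) := hvw _ (by simp; omega) (by simp; omega)
  have hCD : w (c, d) = v (c, d) := hvw _ (by simp; omega) (by simp; omega)
  have hAD : w (a, d) = v (a, d) := hvw _ (by simp; omega) (by simp; omega)
  simp only [TriangleIneq, hdiag, hsides, hAB, hBC, hCD, hAD, diagonalSum,
    ← Finset.sum_Ico_consecutive (fun l => v (l, l + 1)) hab.le hbc.le,
    ← Finset.sum_Ico_consecutive (fun l => v (l, l + 1)) hbc.le hcd.le]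
  rcases min_cases (v (a, b) + v (c, d))
    (v (a, d) + v (b, c) - ∑ i ∈ Finset.Ico b c, v (i, i + 1)) with ⟨hmin, hle⟩ | ⟨hmin, hle⟩ <;>
  · rw [hmin]
    constructor <;> rintro ⟨⟨h₁, h₂, h₃⟩, h₄, h₅, h₆⟩ <;>
      refine ⟨⟨?_, ?_, ?_⟩, ?_, ?_, ?_⟩ <;> linarith

/-- Let `Γ` and `Γ'` be triangulations of the convex `n`-gon related by a Whitehead move
in the quadrilateral with vertices `a < b < c < d`: `Γ` contains the diagonal `(a,c)`
together with the triangles `(a,b,c)` and `(a,c,d)`, and `Γ' = (Γ \ {(a,c)}) ∪ {(b,d)}`.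
Then the map `ℝ^{Prn Γ} → ℝ^{Prn Γ'}` fixing all common coordinates and sending `u_{ac}`
to `u_{bd} = −u_{ac} + u_{ab} + u_{bc} + u_{cd} + u_{ad}
− min(u_{ab} + u_{cd}, u_{ad} + u_{bc} − Σ_{i=b}^{c−1} u_{i,i+1})`
(with the convention `u_{1n} := λ`) restricts to a bijection from `Δ_Γ` onto `Δ_{Γ'}`. -/
theorem whitehead_move_piecewise_linear_bijection
    (n : ℕ) (hn : 4 ≤ n) (lam : ℝ) (hlam : 0 < lam)
    (Γ Γ' : Finset (ℕ × ℕ)) (a b c d : ℕ)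
    (hΓ : IsTriangulation n Γ) (hΓ' : IsTriangulation n Γ')
    (ha : 1 ≤ a) (hab : a < b) (hbc : b < c) (hcd : c < d) (hd : d ≤ n)
    (hac : (a, c) ∈ Γ)
    (hAB : (a, b) ∈ edgeSet n Γ) (hBC : (b, c) ∈ edgeSet n Γ)
    (hCD : (c, d) ∈ edgeSet n Γ) (hAD : (a, d) ∈ edgeSet n Γ)
    (hflip : Γ' = Γ.erase (a, c) ∪ {(b, d)}) :
    Set.BijOn
      (fun (u : {e // e ∈ prnEdges n Γ} → ℝ) (e : {e // e ∈ prnEdges n Γ'}) =>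
        if (e : ℕ × ℕ) = (b, d) then
          - extCoord n lam Γ u (a, c) + extCoord n lam Γ u (a, b) +
            extCoord n lam Γ u (b, c) + extCoord n lam Γ u (c, d) +
            extCoord n lam Γ u (a, d) -
            min (extCoord n lam Γ u (a, b) + extCoord n lam Γ u (c, d))
              (extCoord n lam Γ u (a, d) + extCoord n lam Γ u (b, c) -
                ∑ i ∈ Finset.Ico b c, extCoord n lam Γ u (i, i + 1))
        else extCoord n lam Γ u (e : ℕ × ℕ))
      (deltaPolytope n lam Γ) (deltaPolytope n lam Γ') := by
  have hex := isExchange_of_flip hΓ hΓ' hab hbc hcd hac hflip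
  have hne : ∀ {i j : ℕ}, (i ≠ a ∨ j ≠ c) → (i ≠ b ∨ j ≠ d) →
      ((i, j) ∈ edgeSet n Γ ↔ (i, j) ∈ edgeSet n Γ') := fun h h' =>
    hex.mem_edgeSet_iff (by simpa [imp_iff_not_or] using h) (by simpa [imp_iff_not_or] using h')
  have hAB' := (hne (by omega) (by omega)).1 hAB
  have hBC' := (hne (by omega) (by omega)).1 hBC
  have hCD' := (hne (by omega) (by omega)).1 hCD
  have hAD' := (hne (by omega) (by omega)).1 hAD
  have hAC : (a, c) ∈ edgeSet n Γ := mem_edgeSet.2 (.inl hac)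
  have hBD : (b, d) ∈ edgeSet n Γ' := mem_edgeSet.2 (.inl (by simp [hflip]))
  have hbij := hex.bijOn_exchangeMap lam (C := diagonalSum a b c d)
    (s := deltaPolytope n lam Γ) (t := deltaPolytope n lam Γ') ?_ fun u => ?_
  · refine hbij.congr fun u _ => funext fun e => ?_
    simp only [exchangeMap, diagonalSum]
    split_ifs <;> ring
  · intro v w hvw
    have hs : ∀ l, v (l, l + 1) = w (l, l + 1) := fun l =>
      hvw _ (hex.side_ne l).1 (hex.side_ne l).2
    rw [diagonalSum, diagonalSum, hvw (a, b), hvw (b, c), hvw (c, d), hvw (a, d)]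
    · simp only [hs]
    all_goals simp; omega
  · have hoff : ∀ e, e ≠ (a, c) → e ≠ (b, d) → _ := fun e hp hq =>
      hex.extCoord_exchangeMap_of_ne lam (diagonalSum a b c d) u hp hq
    have hs := fun l => hoff (l, l + 1) (hex.side_ne l).1 (hex.side_ne l).2
    rw [mem_deltaPolytope_iff, mem_deltaPolytope_iff,
      forall_isTriangleIn_iff ⟨hab, hbc, hAB, hBC, hAC⟩ ⟨hab.trans hbc, hcd, hAC, hCD, hAD⟩
        (hΓ.triangle_of_mem_left hab hbc hcd hAB hBC hCD hAD),
      forall_isTriangleIn_iff ⟨hbc, hcd, hBC', hCD', hBD⟩ ⟨hab, hbc.trans hcd, hAB', hBD, hAD'⟩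
        (hΓ'.triangle_of_mem_right hab hbc hcd hAB' hBC' hCD' hAD'),
      ← triangleIneq_quadrilateral_iff hab hbc hcd hoff hs
        (hex.extCoord_exchangeMap_right lam _ u), ← hex.edgeSet_erase]
    refine and_congr_left' (forall₃_congr fun i j k => forall_congr' fun hT => ?_)
    have hcommon : ∀ e ∈ (edgeSet n Γ).erase (a, c), _ := fun e he =>
      (hoff e (Finset.ne_of_mem_erase he)
        (Finset.ne_of_mem_erase (hex.edgeSet_erase ▸ he))).symm
    exact TriangleIneq.congr (fun l => (hs l).symm) (hcommon _ hT.2.2.1)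
      (hcommon _ hT.2.2.2.1) (hcommon _ hT.2.2.2.2)
end

section
/- For all real numbers r₁, r₂, r₃, r₄ one has min(r₁+r₂, r₃+r₄) − max(|r₁−r₂|, |r₃−r₄|) = min(r₁+r₄, r₂+r₃) − max(|r₁−r₄|, |r₂−r₃|); that is, the intervals [max(|r₁−r₂|,|r₃−r₄|), min(r₁+r₂, r₃+r₄)] and [max(|r₁−r₄|,|r₂−r₃|), min(r₁+r₄, r₂+r₃)] have the same length. -/
/-- For all real numbers `r₁, r₂, r₃, r₄` one has
`min(r₁+r₂, r₃+r₄) − max(|r₁−r₂|, |r₃−r₄|) = min(r₁+r₄, r₂+r₃) − max(|r₁−r₄|, |r₂−r₃|)`: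
the intervals of possible diagonal lengths have the same length. -/
theorem diagonal_ranges_same_length (r₁ r₂ r₃ r₄ : ℝ) :
    min (r₁ + r₂) (r₃ + r₄) - max |r₁ - r₂| |r₃ - r₄| =
      min (r₁ + r₄) (r₂ + r₃) - max |r₁ - r₄| |r₂ - r₃| := by
  refine eq_of_forall_le_iff fun c => ?_
  simp only [le_sub_iff_add_le, le_min_iff]
  simp only [← le_sub_iff_add_le', max_le_iff, abs_le']
  constructor <;> rintro ⟨⟨⟨_, _⟩, _, _⟩, ⟨_, _⟩, _, _⟩ <;>
    refine ⟨⟨⟨?_, ?_⟩, ?_, ?_⟩, ⟨?_, ?_⟩, ?_, ?_⟩ <;>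
    linarith
end

section
/- Let r₁, r₂, r₃, r₄ be positive real numbers with max(|r₁−r₂|, |r₃−r₄|) ≤ min(r₁+r₂, r₃+r₄). Then the affine map u ↦ −u + (r₁+r₂+r₃+r₄) − min(r₁+r₃, r₂+r₄) is a bijection from the closed interval [max(|r₁−r₂|,|r₃−r₄|), min(r₁+r₂, r₃+r₄)] onto the closed interval [max(|r₁−r₄|,|r₂−r₃|), min(r₁+r₄, r₂+r₃)]. -/
/-- If `0 ≤ a + b`, the larger of `|a|` and `|b|` is the larger of `a` and `b`. -/
lemma max_abs_abs_of_add_nonneg {a b : ℝ} (h : 0 ≤ a + b) : max |a| |b| = max a b := by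
  grind

lemma add_sub_max_abs_sub_of_le {a b c d : ℝ} (h : b + d ≤ a + c) :
    a + c - max |a - b| |c - d| = min (a + d) (b + c) := by
  rw [max_abs_abs_of_add_nonneg (by linarith)]
  grind

lemma max_add_sub_max_abs_sub (a b c d : ℝ) :
    max (a + c) (b + d) - max |a - b| |c - d| = min (a + d) (b + c) := by
  rcases le_total (b + d) (a + c) with h | h
  · rw [max_eq_left h, add_sub_max_abs_sub_of_le h]
  · rw [max_eq_right h, abs_sub_comm a, abs_sub_comm c, add_sub_max_abs_sub_of_le h, min_comm]

/-- For positive reals `r₁, r₂, r₃, r₄` with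
`max(|r₁−r₂|, |r₃−r₄|) ≤ min(r₁+r₂, r₃+r₄)`, the affine map
`u ↦ −u + (r₁+r₂+r₃+r₄) − min(r₁+r₃, r₂+r₄)` is a bijection from the closed interval
`[max(|r₁−r₂|,|r₃−r₄|), min(r₁+r₂, r₃+r₄)]` onto the closed interval
`[max(|r₁−r₄|,|r₂−r₃|), min(r₁+r₄, r₂+r₃)]`. -/
theorem affine_map_bijOn_diagonal_ranges (r₁ r₂ r₃ r₄ : ℝ)
    (h₁ : 0 < r₁) (h₂ : 0 < r₂) (h₃ : 0 < r₃) (h₄ : 0 < r₄)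
    (hne : max |r₁ - r₂| |r₃ - r₄| ≤ min (r₁ + r₂) (r₃ + r₄)) :
    Set.BijOn (fun u : ℝ => -u + (r₁ + r₂ + r₃ + r₄) - min (r₁ + r₃) (r₂ + r₄))
      (Set.Icc (max |r₁ - r₂| |r₃ - r₄|) (min (r₁ + r₂) (r₃ + r₄)))
      (Set.Icc (max |r₁ - r₄| |r₂ - r₃|) (min (r₁ + r₄) (r₂ + r₃))) := by
  have hmap : (fun u : ℝ => -u + (r₁ + r₂ + r₃ + r₄) - min (r₁ + r₃) (r₂ + r₄)) =
      fun u => max (r₁ + r₃) (r₂ + r₄) - u := by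
    funext u
    linarith [min_add_max (r₁ + r₃) (r₂ + r₄)]
  have hupper := max_add_sub_max_abs_sub r₁ r₂ r₃ r₄
  have hlower : max (r₁ + r₃) (r₂ + r₄) - min (r₁ + r₂) (r₃ + r₄) =
      max |r₁ - r₄| |r₂ - r₃| := by
    have h := max_add_sub_max_abs_sub r₁ r₄ r₃ r₂
    rw [add_comm r₄ r₂, add_comm r₄ r₃, abs_sub_comm r₃] at h
    linarith
  rw [hmap, ← hupper, ← hlower, ← Set.image_const_sub_Icc]
  exact sub_right_injective.injOn.bijOn_image
end

section
/- Let K be a field and let y, y', y₁, y₂, y₃, y₄ be nonzero elements of K with y₁y₃ + y₂y₄ ≠ 0, and suppose y' = (y₁y₂y₃y₄) / (y·(y₁y₃ + y₂y₄)). Then y₁y/y₂ + y₂y/y₁ + y₁y₂/y + y₃y/y₄ + y₄y/y₃ + y₃y₄/y = y₁y'/y₄ + y₄y'/y₁ + y₁y₄/y' + y₂y'/y₃ + y₃y'/y₂ + y₂y₃/y'. Equivalently, ((y₁y₃+y₂y₄)(y₁y₄+y₂y₃)/(y₁y₂y₃y₄))·y + (y₁y₂+y₃y₄)/y = ((y₁y₃+y₂y₄)(y₁y₂+y₃y₄)/(y₁y₂y₃y₄))·y'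 + (y₁y₄+y₂y₃)/y'. -/
/-- For nonzero elements `y, y', y₁, y₂, y₃, y₄` of a field with `y₁y₃ + y₂y₄ ≠ 0` and
`y' = y₁y₂y₃y₄/(y(y₁y₃+y₂y₄))`, the six-term sums of the two triangles of a triangulated
quadrilateral agree:
`y₁y/y₂ + y₂y/y₁ + y₁y₂/y + y₃y/y₄ + y₄y/y₃ + y₃y₄/y
  = y₁y'/y₄ + y₄y'/y₁ + y₁y₄/y' + y₂y'/y₃ + y₃y'/y₂ + y₂y₃/y'`,
and equivalently
`((y₁y₃+y₂y₄)(y₁y₄+y₂y₃)/(y₁y₂y₃y₄))y + (y₁y₂+y₃y₄)/y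
  = ((y₁y₃+y₂y₄)(y₁y₂+y₃y₄)/(y₁y₂y₃y₄))y' + (y₁y₄+y₂y₃)/y'`. -/
theorem cluster_transformation_potential (K : Type*) [Field K]
    (y y' y₁ y₂ y₃ y₄ : K)
    (hy : y ≠ 0) (hy' : y' ≠ 0) (h₁ : y₁ ≠ 0) (h₂ : y₂ ≠ 0) (h₃ : y₃ ≠ 0) (h₄ : y₄ ≠ 0)
    (hden : y₁ * y₃ + y₂ * y₄ ≠ 0)
    (hrel : y' = y₁ * y₂ * y₃ * y₄ / (y * (y₁ * y₃ + y₂ * y₄))) :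
    (y₁ * y / y₂ + y₂ * y / y₁ + y₁ * y₂ / y + y₃ * y / y₄ + y₄ * y / y₃ + y₃ * y₄ / y =
      y₁ * y' / y₄ + y₄ * y' / y₁ + y₁ * y₄ / y' + y₂ * y' / y₃ + y₃ * y' / y₂ +
        y₂ * y₃ / y') ∧
    ((y₁ * y₃ + y₂ * y₄) * (y₁ * y₄ + y₂ * y₃) / (y₁ * y₂ * y₃ * y₄) * y +
        (y₁ * y₂ + y₃ * y₄) / y =
      (y₁ * y₃ + y₂ * y₄) * (y₁ * y₂ + y₃ * y₄) / (y₁ * y₂ * y₃ * y₄) * y' +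
        (y₁ * y₄ + y₂ * y₃) / y') := by
  have collected : (y₁ * y₃ + y₂ * y₄) * (y₁ * y₄ + y₂ * y₃) / (y₁ * y₂ * y₃ * y₄) * y +
        (y₁ * y₂ + y₃ * y₄) / y =
      (y₁ * y₃ + y₂ * y₄) * (y₁ * y₂ + y₃ * y₄) / (y₁ * y₂ * y₃ * y₄) * y' +
        (y₁ * y₄ + y₂ * y₃) / y' := by
    subst hrel
    field_simp
    ring
  refine ⟨?_, collected⟩
  clear hrel
  calc
    _ = (y₁ * y₃ + y₂ * y₄) * (y₁ * y₄ + y₂ * y₃) / (y₁ * y₂ * y₃ * y₄) * y +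
        (y₁ * y₂ + y₃ * y₄) / y := by
      field_simp
      ring
    _ = _ := collected
    _ = _ := by
      field_simp
      ring
end

section
/- Let K be a field, n ≥ 4 an integer, q a nonzero element of K, and p a function assigning to each pair (i,j) with 1 ≤ i < j ≤ n a nonzero element p_{ij} of K. Define nonzero elements y_{ij} for 1 ≤ i < j ≤ n by: y_{ij} = p_{j,j+1}/p_{ij} if j ≤ n−1; y_{in} = q·p_{1n}/p_{in} if 2 ≤ i ≤ n−1; and y_{1n} = q. Then for every quadruple 1 ≤ a < b < c < d ≤ n, the identity 1/(y_{ac}·y_{bd}) = 1/(y_{ab}·y_{cd}·∏_{i=b}^{c−1} y_{i,i+1}) + 1/(y_{ad}·y_{bc}) holds if and only if the Plücker relation p_{ac}·p_{bd} = p_{ab}·p_{cd} + p_{ad}·p_{bc} holds. -/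
theorem prod_Ico_div_of_ne_zero {K : Type*} [Field K] (f : ℕ → K) {m n : ℕ} (hmn : m ≤ n)
    (hf : ∀ i, m ≤ i → i ≤ n → f i ≠ 0) :
    ∏ i ∈ Finset.Ico m n, f (i + 1) / f i = f n / f m := by
  induction n, hmn using Nat.le_induction with
  | base => simp [hf m le_rfl le_rfl]
  | succ n hmn ih =>
    rw [Finset.prod_Ico_succ_top hmn, ih fun i hi hin => hf i hi (by omega), mul_comm,
      div_mul_div_cancel₀ (hf n hmn (by omega))]


/-- Let `K` be a field, `n ≥ 4`, `q ≠ 0`, and `p_{ij} ≠ 0` for `1 ≤ i < j ≤ n`.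
Define `y_{ij} = p_{j,j+1}/p_{ij}` for `j ≤ n−1`, `y_{in} = q·p_{1n}/p_{in}` for
`2 ≤ i ≤ n−1`, and `y_{1n} = q`.  Then for every `1 ≤ a < b < c < d ≤ n`, the identity
`1/(y_{ac}y_{bd}) = 1/(y_{ab}y_{cd}∏_{i=b}^{c−1} y_{i,i+1}) + 1/(y_{ad}y_{bc})` holds
if and only if the Plücker relation `p_{ac}p_{bd} = p_{ab}p_{cd} + p_{ad}p_{bc}` holds. -/
theorem coordinate_change_iff_pluecker (K : Type*) [Field K] (n : ℕ) (hn : 4 ≤ n)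
    (q : K) (hq : q ≠ 0)
    (p : ℕ → ℕ → K) (hp : ∀ i j, 1 ≤ i → i < j → j ≤ n → p i j ≠ 0)
    (y : ℕ → ℕ → K)
    (hy₁ : ∀ i j, 1 ≤ i → i < j → j < n → y i j = p j (j + 1) / p i j)
    (hy₂ : ∀ i, 2 ≤ i → i < n → y i n = q * p 1 n / p i n)
    (hy₃ : y 1 n = q) :
    ∀ a b c d, 1 ≤ a → a < b → b < c → c < d → d ≤ n →
      ((1 / (y a c * y b d) =
          1 / (y a b * y c d * ∏ i ∈ Finset.Ico b c, y i (i + 1)) +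
            1 / (y a d * y b c)) ↔
        p a c * p b d = p a b * p c d + p a d * p b c) := by
  -- `y i j = r j / p i j` with numerators `r j` depending only on the second index
  let r : ℕ → K := fun j => if j < n then p j (j + 1) else q * p 1 n
  have hr : ∀ j, 1 ≤ j → r j ≠ 0 := by
    intro j hj
    by_cases h : j < n
    · simpa [r, h] using hp j (j + 1) hj (by omega) (by omega)
    · simpa [r, h, hq] using hp 1 n (by omega) (by omega) le_rfl
  have hy : ∀ i j, 1 ≤ i → i < j → j ≤ n → y i j = r j / p i j := by
    intro i j hi hij hj
    rcases hj.lt_or_eq with h | rfl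
    · simpa [r, h] using hy₁ i j hi hij h
    · rcases hi.lt_or_eq with h1 | rfl
      · simpa [r] using hy₂ i h1 hij
      · have h0 := hp 1 j le_rfl hij le_rfl
        simp [r, hy₃, h0]
  intro a b c d ha hab hbc hcd hd
  have hprod : ∏ i ∈ Finset.Ico b c, y i (i + 1) = r c / r b := by
    rw [← prod_Ico_div_of_ne_zero r hbc.le fun i hi _ => hr i (by omega)]
    refine Finset.prod_congr rfl fun i hi => ?_
    rw [Finset.mem_Ico] at hi
    rw [hy i (i + 1) (by omega) (by omega) (by omega)]
    congr 1
    simp [r, show i < n by omega]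
  rw [hprod, hy a c (by omega) (by omega) (by omega), hy b d (by omega) (by omega) (by omega),
    hy a b (by omega) (by omega) (by omega), hy c d (by omega) (by omega) (by omega),
    hy a d (by omega) (by omega) (by omega), hy b c (by omega) (by omega) (by omega)]
  have hrb := hr b (by omega)
  have hrc := hr c (by omega)
  have hrd := hr d (by omega)
  have hl : 1 / (r c / p a c * (r d / p b d)) = p a c * p b d / (r c * r d) := by
    simp [div_mul_div_comm]
  have hm : 1 / (r b / p a b * (r d / p c d) * (r c / r b)) = p a b * p c d / (r c * r d) := by
    rw [show r b / p a b * (r d / p c d) * (r c / r b) = r c * r d / (p a b * p c d) by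
      field_simp, one_div_div]
  have hn' : 1 / (r d / p a d * (r c / p b c)) = p a d * p b c / (r c * r d) := by
    simp [div_mul_div_comm, mul_comm (r c)]
  rw [hl, hm, hn', ← add_div, div_left_inj' (mul_ne_zero hrc hrd)]
end

section
/- Let K be a field and let q, y₁₂, y₂₃, y₃₄, y₁₃, y₂₄ be nonzero elements of K with y₁₂y₃₄ + q ≠ 0, satisfying the relation 1/(y₁₃·y₂₄) = (1/(q·y₂₃))·(1 + q/(y₁₂·y₃₄)), i.e. y₂₄ = q·y₁₂·y₂₃·y₃₄ / (y₁₃·(y₁₂y₃₄ + q)). Then y₁₃/y₁₂ + y₁₃/y₂₃ + y₁₂y₂₃/y₁₃ + q·y₁₃/(y₁₂y₂₃y₃₄) + y₁₃y₃₄/q + q/y₁₃ = y₂₄/y₂₃ + y₂₄/y₃₄ + y₂₃y₃₄/y₂₄ + q·y₂₄/(y₁₂y₂₃y₃₄) + y₁₂y₂₄/q + q/y₂₄. -/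
/-- The potential functions `W_Γ` and `W_{Γ'}` of the two triangulations of the square are
related by the cluster transformation
`y₂₄ = q·y₁₂·y₂₃·y₃₄ / (y₁₃·(y₁₂y₃₄ + q))`. -/
theorem potential_Gr24_wall_crossing (K : Type*) [Field K]
    (q y₁₂ y₂₃ y₃₄ y₁₃ y₂₄ : K)
    (hq : q ≠ 0) (h₁₂ : y₁₂ ≠ 0) (h₂₃ : y₂₃ ≠ 0) (h₃₄ : y₃₄ ≠ 0)
    (h₁₃ : y₁₃ ≠ 0) (h₂₄ : y₂₄ ≠ 0)
    (hden : y₁₂ * y₃₄ + q ≠ 0)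
    (hrel : y₂₄ = q * y₁₂ * y₂₃ * y₃₄ / (y₁₃ * (y₁₂ * y₃₄ + q))) :
    y₁₃ / y₁₂ + y₁₃ / y₂₃ + y₁₂ * y₂₃ / y₁₃ + q * y₁₃ / (y₁₂ * y₂₃ * y₃₄) +
        y₁₃ * y₃₄ / q + q / y₁₃ =
      y₂₄ / y₂₃ + y₂₄ / y₃₄ + y₂₃ * y₃₄ / y₂₄ + q * y₂₄ / (y₁₂ * y₂₃ * y₃₄) +
        y₁₂ * y₂₄ / q + q / y₂₄ := by
  subst hrel
  field_simp
  ring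
end

section
/- Let K be a field, 1 ≤ a < b < c < d, and let y_{ab}, y_{bc}, y_{cd}, y_{ad}, y_{ac}, y_{bd}, and y_{i,i+1} for b ≤ i ≤ c−1 be nonzero elements of K; write Π = ∏_{i=b}^{c−1} y_{i,i+1} and assume y_{ab}y_{cd}·Π + y_{ad}y_{bc} ≠ 0. Then the following two statements are equivalent: (i) y_{ac}·y_{bd} = (y_{ab}·y_{bc}·y_{cd}·y_{ad}) / ( y_{ab}·y_{cd} + y_{ad}·y_{bc}/Π ); (ii) z₃ = z₁ + z₂, where z₁ = y_{ab}·y_{ac} / (y_{bc}·∏_{i=a}^{b−1} y_{i,i+1}), z₂ = y_{ad}·y_{ac} / (y_{cd}·∏_{i=a}^{c−1} y_{i,i+1}), and z₃ = y_{ab}·y_{ad} / (y_{bd}·∏_{i=a}^{b−1} y_{i,i+1}), with the elements y_{i,i+1} for a ≤ i ≤ b−1 also assumed nonzero. -/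
/-- The geometric-lift coordinate change (i) relating the potential functions of two
triangulations related by a Whitehead move in the quadrilateral with vertices
`a < b < c < d` is equivalent to the wall-crossing formula (ii) `z₃ = z₁ + z₂`. -/
theorem geometric_lift_iff_wall_crossing (K : Type*) [Field K]
    (a b c d : ℕ) (ha : 1 ≤ a) (hab : a < b) (hbc : b < c) (hcd : c < d)
    (yab ybc ycd yad yac ybd : K) (yside : ℕ → K)
    (hab0 : yab ≠ 0) (hbc0 : ybc ≠ 0) (hcd0 : ycd ≠ 0) (had0 : yad ≠ 0)
    (hac0 : yac ≠ 0) (hbd0 : ybd ≠ 0)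
    (hside : ∀ i, a ≤ i → i < c → yside i ≠ 0)
    (hden : yab * ycd * (∏ i ∈ Finset.Ico b c, yside i) + yad * ybc ≠ 0) :
    (yac * ybd =
        yab * ybc * ycd * yad /
          (yab * ycd + yad * ybc / ∏ i ∈ Finset.Ico b c, yside i)) ↔
      (yab * yad / (ybd * ∏ i ∈ Finset.Ico a b, yside i) =
        yab * yac / (ybc * ∏ i ∈ Finset.Ico a b, yside i) +
          yad * yac / (ycd * ∏ i ∈ Finset.Ico a c, yside i)) := by
  rw [← Finset.prod_Ico_consecutive yside hab.le hbc.le]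
  have hP : ∏ i ∈ Finset.Ico a b, yside i ≠ 0 := Finset.prod_ne_zero_iff.mpr fun i hi =>
    hside i (Finset.mem_Ico.mp hi).1 ((Finset.mem_Ico.mp hi).2.trans hbc)
  have hQ : ∏ i ∈ Finset.Ico b c, yside i ≠ 0 := Finset.prod_ne_zero_iff.mpr fun i hi =>
    hside i (hab.le.trans (Finset.mem_Ico.mp hi).1) (Finset.mem_Ico.mp hi).2
  generalize ∏ i ∈ Finset.Ico a b, yside i = P at *
  generalize ∏ i ∈ Finset.Ico b c, yside i = Q at *
  have hL : yab * ycd + yad * ybc / Q = (yab * ycd * Q + yad * ybc) / Q := by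
    field_simp
  have hR : yab * yac / (ybc * P) + yad * yac / (ycd * (P * Q)) =
      yac * (yab * ycd * Q + yad * ybc) / (ybc * ycd * Q * P) := by
    field_simp
  rw [hL, hR, div_div_eq_mul_div, eq_div_iff hden,
    div_eq_div_iff (mul_ne_zero hbd0 hP)
      (mul_ne_zero (mul_ne_zero (mul_ne_zero hbc0 hcd0) hQ) hP)]
  constructor
  · intro h
    linear_combination (-P) * h
  · intro h
    apply mul_right_cancel₀ hP
    linear_combination -h
end

section
/- Let r₁, r₂, r₃, r₄ be positive real numbers and define the polynomial F(v₁, v₂) = v₁²v₂ + v₁v₂² − (r₁²+r₂²+r₃²+r₄²)·v₁v₂ + (r₁²−r₄²)(r₂²−r₃²)·v₁ + (r₁²−r₂²)(r₄²−r₃²)·v₂ + (r₁²−r₂²+r₃²−r₄²)(r₁²r₃² − r₂²r₄²). Then for every planar closed quadrilateral, i.e. every quadruple ξ₁, ξ₂, ξ₃, ξ₄ ∈ ℝ² with ‖ξ_i‖ = r_i for i = 1,…,4 and ξ₁+ξ₂+ξ₃+ξ₄ = 0, one has F( ‖ξ₁+ξ₂‖² , ‖ξ₂+ξ₃‖² )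 = 0. -/
/-- For every planar closed quadrilateral `ξ₁+ξ₂+ξ₃+ξ₄ = 0` in `ℝ²` with side lengths
`‖ξ_i‖ = r_i`, the squared diagonals `v₁ = ‖ξ₁+ξ₂‖²` and `v₂ = ‖ξ₂+ξ₃‖²` satisfy
`F(v₁,v₂) = 0`, where `F` is the cubic defining the boundary of the image of the polygon
space under `((φ₁₃)², (φ₂₄)²)`. -/
theorem planar_quadrilateral_boundary_cubic (r₁ r₂ r₃ r₄ : ℝ)
    (h₁ : 0 < r₁) (h₂ : 0 < r₂) (h₃ : 0 < r₃) (h₄ : 0 < r₄)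
    (ξ₁ ξ₂ ξ₃ ξ₄ : EuclideanSpace ℝ (Fin 2))
    (hn₁ : ‖ξ₁‖ = r₁) (hn₂ : ‖ξ₂‖ = r₂) (hn₃ : ‖ξ₃‖ = r₃) (hn₄ : ‖ξ₄‖ = r₄)
    (hsum : ξ₁ + ξ₂ + ξ₃ + ξ₄ = 0)
    (v₁ v₂ : ℝ) (hv₁ : v₁ = ‖ξ₁ + ξ₂‖ ^ 2) (hv₂ : v₂ = ‖ξ₂ + ξ₃‖ ^ 2) :
    v₁ ^ 2 * v₂ + v₁ * v₂ ^ 2 - (r₁ ^ 2 + r₂ ^ 2 + r₃ ^ 2 + r₄ ^ 2) * (v₁ * v₂) +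
        (r₁ ^ 2 - r₄ ^ 2) * (r₂ ^ 2 - r₃ ^ 2) * v₁ +
        (r₁ ^ 2 - r₂ ^ 2) * (r₄ ^ 2 - r₃ ^ 2) * v₂ +
        (r₁ ^ 2 - r₂ ^ 2 + r₃ ^ 2 - r₄ ^ 2) * (r₁ ^ 2 * r₃ ^ 2 - r₂ ^ 2 * r₄ ^ 2) = 0 := by
  have h : ξ₄ = -(ξ₁ + ξ₂ + ξ₃) := (neg_eq_of_add_eq_zero_right hsum).symm
  subst h hn₁ hn₂ hn₃ hn₄ hv₁ hv₂
  simp only [EuclideanSpace.real_norm_sq_eq, Fin.sum_univ_two, PiLp.add_apply, PiLp.neg_apply]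
  ring
end

section
/- Let r₁, r₂, r₃, r₄ be positive real numbers with max(|r₁−r₂|, |r₃−r₄|) ≤ min(r₁+r₂, r₃+r₄), and let S = { ( ‖ξ₁+ξ₂‖² , ‖ξ₂+ξ₃‖² ) : ξ₁,…,ξ₄ ∈ ℝ³, ‖ξ_i‖ = r_i, ξ₁+ξ₂+ξ₃+ξ₄ = 0 } ⊆ ℝ². Then for every t ∈ (0,1) and every c ∈ ℝ: (i) the intersection S ∩ { (v₁,v₂) ∈ ℝ² : (1−t)v₁ − t·v₂ = c } is a convex set (i.e. a line segment, a single point, or empty); and (ii) if c is the maximum or the minimum of the set I = { (1−t)v₁ − t·v₂ : (v₁,v₂) ∈ S }, then this intersection is a single point. -/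
open Matrix

open scoped MatrixOrder

/-- A real positive semidefinite matrix is a Gram matrix of vectors in a Euclidean space whose
dimension is the size of the matrix. -/
theorem Matrix.PosSemidef.exists_gram_eq {n : Type*} [Fintype n] [DecidableEq n]
    {A : Matrix n n ℝ} (hA : A.PosSemidef) :
    ∃ v : n → EuclideanSpace ℝ n, gram ℝ v = A := by
  obtain ⟨B, rfl⟩ := CStarAlgebra.nonneg_iff_eq_star_mul_self.mp hA.nonneg
  refine ⟨fun i => WithLp.toLp 2 fun k => B k i, ?_⟩
  ext i j
  simp [Matrix.mul_apply, PiLp.inner_apply, mul_comm, star_eq_conjTranspose]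

/-- A real positive definite matrix stays positive semidefinite under small symmetric
perturbations. -/
theorem Matrix.PosDef.exists_pos_posSemidef_add_smul {n : Type*} [Fintype n]
    {A B : Matrix n n ℝ} (hA : A.PosDef) (hB : B.IsHermitian) :
    ∃ ε > 0, ∀ s : ℝ, |s| ≤ ε → (A + s • B).PosSemidef := by
  have hcont (M : Matrix n n ℝ) : Continuous fun x : n → ℝ => x ⬝ᵥ (M *ᵥ x) := by fun_prop
  have hpos : ∀ x : n → ℝ, x ≠ 0 → 0 < x ⬝ᵥ (A *ᵥ x) := fun x hx => by
    simpa using hA.dotProduct_mulVec_pos hx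
  obtain ⟨K, hK⟩ := (isCompact_sphere (0 : n → ℝ) 1).exists_bound_of_continuousOn
    (f := fun x => x ⬝ᵥ (B *ᵥ x) / x ⬝ᵥ (A *ᵥ x))
    ((hcont B).continuousOn.div (hcont A).continuousOn fun x hx =>
      (hpos x (ne_zero_of_mem_unit_sphere ⟨x, hx⟩)).ne')
  have hbound : ∀ x : n → ℝ, |x ⬝ᵥ (B *ᵥ x)| ≤ |K| * x ⬝ᵥ (A *ᵥ x) := fun x => by
    obtain rfl | hx := eq_or_ne x 0
    · simp
    have hxn : 0 < ‖x‖ := norm_pos_iff.mpr hx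
    have h := hK (‖x‖⁻¹ • x) (by simp [norm_smul, hxn.ne'])
    have hx' := hpos x hx
    simp only [mulVec_smul, smul_dotProduct, dotProduct_smul, smul_eq_mul] at h
    rw [mul_div_mul_left _ _ (by positivity), mul_div_mul_left _ _ (by positivity),
      Real.norm_eq_abs, abs_div, abs_of_pos hx', div_le_iff₀ hx'] at h
    exact h.trans (by gcongr; exact le_abs_self K)
  refine ⟨(|K| + 1)⁻¹, by positivity, fun s hs => ?_⟩
  refine .of_dotProduct_mulVec_nonneg (hA.isHermitian.add (hB.smul (IsSelfAdjoint.all s)))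
    fun x => ?_
  have hA0 : 0 ≤ x ⬝ᵥ (A *ᵥ x) := by simpa using hA.posSemidef.dotProduct_mulVec_nonneg x
  have h : |s * x ⬝ᵥ (B *ᵥ x)| ≤ x ⬝ᵥ (A *ᵥ x) := by
    rw [abs_mul]
    calc |s| * |x ⬝ᵥ (B *ᵥ x)| ≤ (|K| + 1)⁻¹ * ((|K| + 1) * x ⬝ᵥ (A *ᵥ x)) := by
          gcongr
          exact (hbound x).trans (by nlinarith)
      _ = x ⬝ᵥ (A *ᵥ x) := by field_simp
  simp only [star_trivial, add_mulVec, smul_mulVec, dotProduct_add, dotProduct_smul, smul_eq_mul]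
  linarith [neg_le_of_abs_le h]

/-- The Gram matrix of the first three edges of a closed quadrilateral with squared side lengths
`a, b, c, d` and squared diagonal lengths `p.1, p.2`. -/
noncomputable def quadrilateralGram (a b c d : ℝ) (p : ℝ × ℝ) : Matrix (Fin 3) (Fin 3) ℝ :=
  !![a, (p.1 - a - b) / 2, (b + d - p.1 - p.2) / 2;
     (p.1 - a - b) / 2, b, (p.2 - b - c) / 2;
     (b + d - p.1 - p.2) / 2, (p.2 - b - c) / 2, c]

theorem posSemidef_quadrilateralGram_iff {r₁ r₂ r₃ r₄ : ℝ}
    (h₁ : 0 ≤ r₁) (h₂ : 0 ≤ r₂) (h₃ : 0 ≤ r₃) (h₄ : 0 ≤ r₄) (p : ℝ × ℝ) :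
    (quadrilateralGram (r₁ ^ 2) (r₂ ^ 2) (r₃ ^ 2) (r₄ ^ 2) p).PosSemidef ↔
      ∃ ξ₁ ξ₂ ξ₃ ξ₄ : EuclideanSpace ℝ (Fin 3),
        ‖ξ₁‖ = r₁ ∧ ‖ξ₂‖ = r₂ ∧ ‖ξ₃‖ = r₃ ∧ ‖ξ₄‖ = r₄ ∧
        ξ₁ + ξ₂ + ξ₃ + ξ₄ = 0 ∧ p = (‖ξ₁ + ξ₂‖ ^ 2, ‖ξ₂ + ξ₃‖ ^ 2) := by
  have expand (u v w : EuclideanSpace ℝ (Fin 3)) : ‖u + v + w‖ ^ 2 =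
      ‖u‖ ^ 2 + ‖v‖ ^ 2 + ‖w‖ ^ 2 + 2 * inner ℝ u v + 2 * inner ℝ u w + 2 * inner ℝ v w := by
    rw [norm_add_sq_real, norm_add_sq_real, inner_add_left]
    ring
  constructor
  · intro h
    obtain ⟨v, hv⟩ := h.exists_gram_eq
    have entry (i j : Fin 3) : inner ℝ (v i) (v j) =
        quadrilateralGram (r₁ ^ 2) (r₂ ^ 2) (r₃ ^ 2) (r₄ ^ 2) p i j := by
      rw [← hv, gram_apply]
    have e00 : ‖v 0‖ ^ 2 = r₁ ^ 2 := by
      rw [← real_inner_self_eq_norm_sq, entry]; simp [quadrilateralGram]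
    have e11 : ‖v 1‖ ^ 2 = r₂ ^ 2 := by
      rw [← real_inner_self_eq_norm_sq, entry]; simp [quadrilateralGram]
    have e22 : ‖v 2‖ ^ 2 = r₃ ^ 2 := by
      rw [← real_inner_self_eq_norm_sq, entry]; simp [quadrilateralGram]
    have e01 := entry 0 1
    have e02 := entry 0 2
    have e12 := entry 1 2
    simp only [quadrilateralGram, of_apply, cons_val] at e01 e02 e12
    refine ⟨v 0, v 1, v 2, -(v 0 + v 1 + v 2), (sq_eq_sq₀ (norm_nonneg _) h₁).mp e00,
      (sq_eq_sq₀ (norm_nonneg _) h₂).mp e11, (sq_eq_sq₀ (norm_nonneg _) h₃).mp e22, ?_,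
      add_neg_cancel _, ?_⟩
    · rw [norm_neg, ← sq_eq_sq₀ (norm_nonneg _) h₄, expand, e00, e11, e22, e01, e02, e12]
      ring
    · rw [norm_add_sq_real, norm_add_sq_real, e00, e11, e22, e01, e12]
      ext <;> ring
  · rintro ⟨ξ₁, ξ₂, ξ₃, ξ₄, rfl, rfl, rfl, rfl, hsum, rfl⟩
    have h4 : ‖ξ₄‖ ^ 2 = ‖ξ₁ + ξ₂ + ξ₃‖ ^ 2 := by
      rw [eq_neg_of_add_eq_zero_left hsum, norm_neg]
    suffices h : quadrilateralGram (‖ξ₁‖ ^ 2) (‖ξ₂‖ ^ 2) (‖ξ₃‖ ^ 2) (‖ξ₄‖ ^ 2)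
        (‖ξ₁ + ξ₂‖ ^ 2, ‖ξ₂ + ξ₃‖ ^ 2) = gram ℝ ![ξ₁, ξ₂, ξ₃] from
      h ▸ posSemidef_gram ℝ ![ξ₁, ξ₂, ξ₃]
    rw [h4, expand]
    ext i j
    fin_cases i <;> fin_cases j <;>
      simp [quadrilateralGram, norm_add_sq_real, real_inner_comm] <;> ring

theorem quadrilateralGram_combo (a b c d : ℝ) (p q : ℝ × ℝ) {α β : ℝ} (hαβ : α + β = 1) :
    quadrilateralGram a b c d (α • p + β • q) =
      α • quadrilateralGram a b c d p + β • quadrilateralGram a b c d q := by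
  obtain rfl := eq_sub_of_add_eq hαβ
  ext i j
  fin_cases i <;> fin_cases j <;> simp [quadrilateralGram] <;> ring

theorem convex_setOf_posSemidef_quadrilateralGram (a b c d : ℝ) :
    Convex ℝ {p | (quadrilateralGram a b c d p).PosSemidef} := by
  intro p hp q hq α β hα hβ hαβ
  rw [Set.mem_ofPred_eq, quadrilateralGram_combo _ _ _ _ _ _ hαβ]
  exact (PosSemidef.smul hp hα).add (PosSemidef.smul hq hβ)

/-- Moving the first diagonal in both directions from a nondegenerate quadrilateral. -/
theorem exists_pos_posSemidef_quadrilateralGram {a b c d : ℝ} {p : ℝ × ℝ}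
    (hp : (quadrilateralGram a b c d p).PosDef) :
    ∃ ε > 0, ∀ s : ℝ, |s| ≤ ε → (quadrilateralGram a b c d (p.1 + s, p.2)).PosSemidef := by
  have hB : (!![0, 1 / 2, -1 / 2; 1 / 2, 0, 0; -1 / 2, 0, 0] :
      Matrix (Fin 3) (Fin 3) ℝ).IsHermitian := by
    ext i j
    fin_cases i <;> fin_cases j <;> simp
  obtain ⟨ε, hε, h⟩ := hp.exists_pos_posSemidef_add_smul hB
  refine ⟨ε, hε, fun s hs => ?_⟩
  convert h s hs using 1
  ext i j
  fin_cases i <;> fin_cases j <;> simp [quadrilateralGram] <;> ring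

/-- The Gram determinant restricted to a line of direction `(t, 1 - t)` is a cubic polynomial
whose leading coefficient is nonzero for `t ∈ (0, 1)`, so it does not vanish identically on a
nontrivial segment. -/
theorem exists_det_quadrilateralGram_ne_zero (a b c d : ℝ) (p : ℝ × ℝ) {t k : ℝ}
    (ht : t ∈ Set.Ioo (0 : ℝ) 1) (hk : k ≠ 0) :
    ∃ s ∈ Set.Icc (0 : ℝ) 1,
      (quadrilateralGram a b c d (p + s • (k * t, k * (1 - t)))).det ≠ 0 := by
  by_contra! h
  have h0 := h 0 (by norm_num)
  have h1 := h (1 / 3) (by norm_num)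
  have h2 := h (2 / 3) (by norm_num)
  have h3 := h 1 (by norm_num)
  simp only [quadrilateralGram, det_fin_three, of_apply, cons_val, Prod.fst_add, Prod.snd_add,
    Prod.smul_fst, Prod.smul_snd, smul_eq_mul] at h0 h1 h2 h3
  have : k ^ 3 * (t * (1 - t)) = 0 := by
    linear_combination 18 * (h0 - 3 * h1 + 3 * h2 - h3)
  have ht' : t * (1 - t) ≠ 0 := (mul_pos ht.1 (sub_pos.mpr ht.2)).ne'
  exact mul_ne_zero (pow_ne_zero 3 hk) ht' this

/-- Let `S ⊆ ℝ²` be the image of the polygon space of closed quadrilaterals in `ℝ³` with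
side lengths `r₁, …, r₄` under the squared diagonal map `((φ₁₃)², (φ₂₄)²)`.  For every
`t ∈ (0,1)` and `c ∈ ℝ`:
(i) the intersection of `S` with the line `(1−t)v₁ − t·v₂ = c` is convex
(a line segment, a single point, or empty); and
(ii) if `c` is the maximum or the minimum of `I = {(1−t)v₁ − t·v₂ : (v₁,v₂) ∈ S}`, then
this intersection is a single point. -/
theorem level_sets_of_phi_t (r₁ r₂ r₃ r₄ : ℝ)
    (h₁ : 0 < r₁) (h₂ : 0 < r₂) (h₃ : 0 < r₃) (h₄ : 0 < r₄)
    (hne : max |r₁ - r₂| |r₃ - r₄| ≤ min (r₁ + r₂) (r₃ + r₄))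
    (S : Set (ℝ × ℝ))
    (hS : S = {p : ℝ × ℝ | ∃ ξ₁ ξ₂ ξ₃ ξ₄ : EuclideanSpace ℝ (Fin 3),
      ‖ξ₁‖ = r₁ ∧ ‖ξ₂‖ = r₂ ∧ ‖ξ₃‖ = r₃ ∧ ‖ξ₄‖ = r₄ ∧
      ξ₁ + ξ₂ + ξ₃ + ξ₄ = 0 ∧ p = (‖ξ₁ + ξ₂‖ ^ 2, ‖ξ₂ + ξ₃‖ ^ 2)})
    (t c : ℝ) (ht : t ∈ Set.Ioo (0 : ℝ) 1) :
    Convex ℝ (S ∩ {p : ℝ × ℝ | (1 - t) * p.1 - t * p.2 = c}) ∧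
    ((IsGreatest ((fun p : ℝ × ℝ => (1 - t) * p.1 - t * p.2) '' S) c ∨
        IsLeast ((fun p : ℝ × ℝ => (1 - t) * p.1 - t * p.2) '' S) c) →
      ∃ p : ℝ × ℝ, S ∩ {q : ℝ × ℝ | (1 - t) * q.1 - t * q.2 = c} = {p}) := by
  set G := quadrilateralGram (r₁ ^ 2) (r₂ ^ 2) (r₃ ^ 2) (r₄ ^ 2)
  have hSG : S = {p | (G p).PosSemidef} := by
    rw [hS]
    ext p
    exact (posSemidef_quadrilateralGram_iff h₁.le h₂.le h₃.le h₄.le p).symm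
  clear hS
  subst hSG
  have hconv := convex_setOf_posSemidef_quadrilateralGram (r₁ ^ 2) (r₂ ^ 2) (r₃ ^ 2) (r₄ ^ 2)
  have hf : IsLinearMap ℝ fun p : ℝ × ℝ => (1 - t) * p.1 - t * p.2 :=
    ⟨fun p q => by simp only [Prod.fst_add, Prod.snd_add]; ring,
      fun α p => by simp only [Prod.smul_fst, Prod.smul_snd, smul_eq_mul]; ring⟩
  have hline := hconv.inter (convex_hyperplane hf c)
  refine ⟨hline, fun hc => ?_⟩
  obtain ⟨p, hp, hpc⟩ : c ∈ (fun p : ℝ × ℝ => (1 - t) * p.1 - t * p.2) ''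
      {p | (G p).PosSemidef} :=
    hc.elim (·.1) (·.1)
  have not_posDef : ∀ z : ℝ × ℝ, (1 - t) * z.1 - t * z.2 = c → ¬ (G z).PosDef := by
    intro z hz hpd
    obtain ⟨ε, hε, h⟩ := exists_pos_posSemidef_quadrilateralGram hpd
    have ht1 := mul_pos (sub_pos.mpr ht.2) hε
    rcases hc with hc | hc
    · have := hc.2 (Set.mem_image_of_mem _ (h ε (abs_of_pos hε).le))
      dsimp only at this
      linarith
    · have := hc.2 (Set.mem_image_of_mem _ (h (-ε) (by rw [abs_neg, abs_of_pos hε])))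
      dsimp only at this
      linarith
  refine ⟨p, Set.eq_singleton_iff_unique_mem.mpr ⟨⟨hp, hpc⟩, fun q hq => ?_⟩⟩
  by_contra hqp
  have hqc : (1 - t) * q.1 - t * q.2 = c := hq.2
  dsimp only at hpc
  obtain ⟨k, hk⟩ : ∃ k : ℝ, q - p = (k * t, k * (1 - t)) :=
    ⟨(q.1 - p.1) + (q.2 - p.2), Prod.ext
      (by simp only [Prod.fst_sub]; linear_combination hqc - hpc)
      (by simp only [Prod.snd_sub]; linear_combination hpc - hqc)⟩
  have hk0 : k ≠ 0 := by
    rintro rfl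
    exact hqp (sub_eq_zero.mp (by rw [hk, zero_mul, zero_mul]; rfl))
  obtain ⟨s, hs, hdet⟩ :=
    exists_det_quadrilateralGram_ne_zero (r₁ ^ 2) (r₂ ^ 2) (r₃ ^ 2) (r₄ ^ 2) p ht hk0
  rw [← hk] at hdet
  have hz := hline.add_smul_sub_mem ⟨hp, hpc⟩ hq hs
  exact not_posDef _ hz.2 (PosSemidef.posDef_iff_det_ne_zero hz.1 |>.mpr hdet)
end

section
/- Let r₁, r₂, r₃, r₄ be positive real numbers and let v₁ > 0 satisfy max(|r₁−r₂|, |r₃−r₄|) ≤ √v₁ ≤ min(r₁+r₂, r₃+r₄). Define C₁ = (v₁ + r₁² − r₂²)/(2r₁√v₁) and C₄ = (v₁ + r₄² − r₃²)/(2r₄√v₁). Then C₁, C₄ ∈ [−1, 1], and, setting S₁ = √(1−C₁²) and S₄ = √(1−C₄²), the set { ‖ξ₂+ξ₃‖² : ξ₁,…,ξ₄ ∈ ℝ³, ‖ξ_i‖ = r_i, ξ₁+ξ₂+ξ₃+ξ₄ = 0, ‖ξ₁+ξ₂‖² = v₁ } is exactly the closed interval [ r₁² + r₄² − 2r₁r₄(C₁C₄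 + S₁S₄) , r₁² + r₄² − 2r₁r₄(C₁C₄ − S₁S₄) ]. -/
/-- The law-of-cosines quotient of a triangle with sides `a`, `b`, `s` lies in `[-1, 1]`. -/
theorem lawOfCosines_quotient_mem_Icc {a b s : ℝ} (ha : 0 < a) (hs : 0 < s)
    (hlo : |a - b| ≤ s) (hhi : s ≤ a + b) :
    (s ^ 2 + a ^ 2 - b ^ 2) / (2 * a * s) ∈ Set.Icc (-1 : ℝ) 1 := by
  obtain ⟨h₁, h₂⟩ := abs_le.mp hlo
  have hpos : 0 < 2 * a * s := by positivity
  constructor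
  · rw [le_div_iff₀ hpos]
    nlinarith
  · rw [div_le_iff₀ hpos]
    nlinarith

/-- Two vectors making angles with cosines `C`, `C'` with a common vector `d` make an angle with
each other whose cosine differs from `C * C'` by at most the product of the sines. -/
theorem abs_inner_sub_cos_mul_cos_le {E : Type*} [NormedAddCommGroup E] [InnerProductSpace ℝ E]
    {x y d : E} {C C' : ℝ} (hd : ‖d‖ ≠ 0)
    (hx : inner ℝ x d = ‖x‖ * ‖d‖ * C) (hy : inner ℝ y d = ‖y‖ * ‖d‖ * C') :
    |inner ℝ x y - ‖x‖ * ‖y‖ * (C * C')| ≤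
      ‖x‖ * ‖y‖ * (Real.sqrt (1 - C ^ 2) * Real.sqrt (1 - C' ^ 2)) := by
  have perp : ∀ {z : E} {c : ℝ}, inner ℝ z d = ‖z‖ * ‖d‖ * c →
      ‖z - (‖z‖ * c / ‖d‖) • d‖ = ‖z‖ * Real.sqrt (1 - c ^ 2) := by
    intro z c hz
    have hsq : ‖z - (‖z‖ * c / ‖d‖) • d‖ ^ 2 = ‖z‖ ^ 2 * (1 - c ^ 2) := by
      rw [norm_sub_sq_real, inner_smul_right, hz, norm_smul, mul_pow, Real.norm_eq_abs, sq_abs]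
      field_simp
      ring
    rw [← Real.sqrt_sq (norm_nonneg (z - _)), hsq, Real.sqrt_mul (sq_nonneg _),
      Real.sqrt_sq (norm_nonneg _)]
  have hinner : inner ℝ (x - (‖x‖ * C / ‖d‖) • d) (y - (‖y‖ * C' / ‖d‖) • d) =
      inner ℝ x y - ‖x‖ * ‖y‖ * (C * C') := by
    rw [inner_sub_left, inner_sub_right, inner_sub_right, inner_smul_left, inner_smul_right,
      inner_smul_left, inner_smul_right, real_inner_comm y d, hx, hy,
      real_inner_self_eq_norm_sq, conj_trivial]
    field_simp
    ring
  have h := abs_real_inner_le_norm (x - (‖x‖ * C / ‖d‖) • d) (y - (‖y‖ * C' / ‖d‖) • d)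
  rw [hinner, perp hx, perp hy] at h
  linarith

/-- A number of absolute value at most `m` is `t * m` with `t` in `[-1, 1]`. -/
theorem exists_sq_le_one_mul_eq {m y : ℝ} (h : |y| ≤ m) : ∃ t : ℝ, t ^ 2 ≤ 1 ∧ t * m = y := by
  rcases (abs_nonneg y |>.trans h).eq_or_lt with hm | hm
  · refine ⟨0, by norm_num, ?_⟩
    rw [← hm] at h
    rw [abs_nonpos_iff.mp h, zero_mul]
  · refine ⟨y / m, ?_, div_mul_cancel₀ y hm.ne'⟩
    rw [sq_le_one_iff_abs_le_one, abs_div, abs_of_pos hm]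
    exact (div_le_one hm).mpr h

theorem norm_sq_vec3 (a b c : ℝ) :
    ‖(!₂[a, b, c] : EuclideanSpace ℝ (Fin 3))‖ ^ 2 = a ^ 2 + b ^ 2 + c ^ 2 := by
  simp [EuclideanSpace.norm_sq_eq, Fin.sum_univ_three]


/-- Let `r₁, …, r₄ > 0` and `v₁ > 0` with
`max(|r₁−r₂|, |r₃−r₄|) ≤ √v₁ ≤ min(r₁+r₂, r₃+r₄)`.  With
`C₁ = (v₁+r₁²−r₂²)/(2r₁√v₁)`, `C₄ = (v₁+r₄²−r₃²)/(2r₄√v₁)`, `S₁ = √(1−C₁²)`,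
`S₄ = √(1−C₄²)`, one has `C₁, C₄ ∈ [−1,1]`, and the set of values `‖ξ₂+ξ₃‖²` over closed
quadrilaterals in `ℝ³` with side lengths `r_i` and `‖ξ₁+ξ₂‖² = v₁` is exactly the
closed interval
`[r₁²+r₄²−2r₁r₄(C₁C₄+S₁S₄), r₁²+r₄²−2r₁r₄(C₁C₄−S₁S₄)]`. -/
theorem range_of_second_diagonal_on_level_set (r₁ r₂ r₃ r₄ v₁ : ℝ)
    (h₁ : 0 < r₁) (h₂ : 0 < r₂) (h₃ : 0 < r₃) (h₄ : 0 < r₄) (hv : 0 < v₁)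
    (hlo : max |r₁ - r₂| |r₃ - r₄| ≤ Real.sqrt v₁)
    (hhi : Real.sqrt v₁ ≤ min (r₁ + r₂) (r₃ + r₄))
    (C₁ C₄ S₁ S₄ : ℝ)
    (hC₁ : C₁ = (v₁ + r₁ ^ 2 - r₂ ^ 2) / (2 * r₁ * Real.sqrt v₁))
    (hC₄ : C₄ = (v₁ + r₄ ^ 2 - r₃ ^ 2) / (2 * r₄ * Real.sqrt v₁))
    (hS₁ : S₁ = Real.sqrt (1 - C₁ ^ 2)) (hS₄ : S₄ = Real.sqrt (1 - C₄ ^ 2)) :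
    C₁ ∈ Set.Icc (-1 : ℝ) 1 ∧ C₄ ∈ Set.Icc (-1 : ℝ) 1 ∧
    {x : ℝ | ∃ ξ₁ ξ₂ ξ₃ ξ₄ : EuclideanSpace ℝ (Fin 3),
        ‖ξ₁‖ = r₁ ∧ ‖ξ₂‖ = r₂ ∧ ‖ξ₃‖ = r₃ ∧ ‖ξ₄‖ = r₄ ∧
        ξ₁ + ξ₂ + ξ₃ + ξ₄ = 0 ∧ ‖ξ₁ + ξ₂‖ ^ 2 = v₁ ∧ x = ‖ξ₂ + ξ₃‖ ^ 2} =
      Set.Icc (r₁ ^ 2 + r₄ ^ 2 - 2 * r₁ * r₄ * (C₁ * C₄ + S₁ * S₄))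
        (r₁ ^ 2 + r₄ ^ 2 - 2 * r₁ * r₄ * (C₁ * C₄ - S₁ * S₄)) := by
  obtain ⟨s, hs, rfl⟩ : ∃ s : ℝ, 0 < s ∧ v₁ = s ^ 2 :=
    ⟨Real.sqrt v₁, Real.sqrt_pos.mpr hv, (Real.sq_sqrt hv.le).symm⟩
  rw [Real.sqrt_sq hs.le] at hlo hhi hC₁ hC₄
  obtain ⟨hlo₁, hlo₃⟩ := max_le_iff.mp hlo
  obtain ⟨hhi₁, hhi₃⟩ := le_min_iff.mp hhi
  have mem₁ : C₁ ∈ Set.Icc (-1 : ℝ) 1 :=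
    hC₁ ▸ lawOfCosines_quotient_mem_Icc h₁ hs hlo₁ hhi₁
  have mem₄ : C₄ ∈ Set.Icc (-1 : ℝ) 1 :=
    hC₄ ▸ lawOfCosines_quotient_mem_Icc h₄ hs (abs_sub_comm r₃ r₄ ▸ hlo₃) (by linarith)
  have cos₁ : 2 * r₁ * s * C₁ = s ^ 2 + r₁ ^ 2 - r₂ ^ 2 := by rw [hC₁]; field_simp
  have cos₄ : 2 * r₄ * s * C₄ = s ^ 2 + r₄ ^ 2 - r₃ ^ 2 := by rw [hC₄]; field_simp
  refine ⟨mem₁, mem₄, Set.ext fun x => ⟨?_, ?_⟩⟩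
  · rintro ⟨ξ₁, ξ₂, ξ₃, ξ₄, n₁, n₂, n₃, n₄, hsum, hdiag, rfl⟩
    obtain ⟨d, hd⟩ : ∃ d, d = ξ₁ + ξ₂ := ⟨_, rfl⟩
    have nd : ‖d‖ = s := by
      rw [← hd] at hdiag
      exact (sq_eq_sq₀ (norm_nonneg _) hs.le).mp hdiag
    have e₂ : ξ₂ = d - ξ₁ := by rw [hd]; abel
    have e₃ : ξ₃ = -ξ₄ - d := by
      rw [hd, ← sub_eq_zero, ← hsum]; abel
    have i₁ : inner ℝ ξ₁ d = ‖ξ₁‖ * ‖d‖ * C₁ := by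
      have h := norm_sub_sq_real d ξ₁
      rw [← e₂, n₁, n₂, nd, real_inner_comm] at h
      rw [n₁, nd]
      linarith
    have i₄ : inner ℝ (-ξ₄) d = ‖-ξ₄‖ * ‖d‖ * C₄ := by
      have h := norm_sub_sq_real (-ξ₄) d
      rw [← e₃, norm_neg, n₃, n₄, nd] at h
      rw [norm_neg, n₄, nd]
      linarith
    have hle := abs_inner_sub_cos_mul_cos_le (nd ▸ hs.ne') i₁ i₄
    rw [norm_neg, n₁, n₄, ← hS₁, ← hS₄, abs_le] at hle
    have e₂₃ : ξ₂ + ξ₃ = -ξ₄ - ξ₁ := by rw [e₂, e₃]; abel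
    rw [e₂₃, norm_sub_sq_real, norm_neg, n₁, n₄, real_inner_comm]
    constructor <;> linarith [hle.1, hle.2]
  · rintro ⟨hx₁, hx₂⟩
    have hS₁sq : S₁ ^ 2 = 1 - C₁ ^ 2 := by
      rw [hS₁, Real.sq_sqrt]
      nlinarith [mem₁.1, mem₁.2]
    have hS₄sq : S₄ ^ 2 = 1 - C₄ ^ 2 := by
      rw [hS₄, Real.sq_sqrt]
      nlinarith [mem₄.1, mem₄.2]
    obtain ⟨t, ht, hxt⟩ := exists_sq_le_one_mul_eq (m := 2 * r₁ * r₄ * (S₁ * S₄))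
      (y := r₁ ^ 2 + r₄ ^ 2 - 2 * r₁ * r₄ * (C₁ * C₄) - x)
      (abs_le.mpr ⟨by linarith, by linarith⟩)
    obtain ⟨u, hu⟩ : ∃ u : ℝ, u ^ 2 = 1 - t ^ 2 := ⟨_, Real.sq_sqrt (sub_nonneg.mpr ht)⟩
    have norm_eq : ∀ {a b c r : ℝ}, 0 < r → a ^ 2 + b ^ 2 + c ^ 2 = r ^ 2 →
        ‖(!₂[a, b, c] : EuclideanSpace ℝ (Fin 3))‖ = r := fun hr h =>
      (sq_eq_sq₀ (norm_nonneg _) hr.le).mp ((norm_sq_vec3 _ _ _).trans h)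
    have add_vec : ∀ a b c a' b' c' : ℝ, (!₂[a, b, c] + !₂[a', b', c'] :
        EuclideanSpace ℝ (Fin 3)) = !₂[a + a', b + b', c + c'] := by
      intro a b c a' b' c'
      ext i
      fin_cases i <;> simp
    refine ⟨!₂[r₁ * C₁, r₁ * S₁, 0], !₂[s - r₁ * C₁, -(r₁ * S₁), 0],
      !₂[r₄ * C₄ - s, r₄ * (S₄ * t), r₄ * (S₄ * u)],
      !₂[-(r₄ * C₄), -(r₄ * (S₄ * t)), -(r₄ * (S₄ * u))],
      norm_eq h₁ ?_, norm_eq h₂ ?_, norm_eq h₃ ?_, norm_eq h₄ ?_, ?_, ?_, ?_⟩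
    · linear_combination r₁ ^ 2 * hS₁sq
    · linear_combination r₁ ^ 2 * hS₁sq - cos₁
    · linear_combination r₄ ^ 2 * hS₄sq - cos₄ + r₄ ^ 2 * S₄ ^ 2 * hu
    · linear_combination r₄ ^ 2 * hS₄sq + r₄ ^ 2 * S₄ ^ 2 * hu
    · ext i
      fin_cases i <;> simp
    · rw [add_vec, norm_sq_vec3]
      ring
    · rw [add_vec, norm_sq_vec3]
      linear_combination hxt - r₁ ^ 2 * hS₁sq - r₄ ^ 2 * hS₄sq - r₄ ^ 2 * S₄ ^ 2 * hu
end
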